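/- Let p be a prime with p ≡ 1 (mod 4), n ≥ 2 an integer with p > 9n², and A an integer with 0 < |A| < p/2 and A ≠ ±1. Then the map f(x) = (A x^{(p+1)/2} mod p) is not of Type (iii): there are no indices i, j with 0 ≤ i, j ≤ n−1 and f(I_i) ⊆ I_j. -/

import Mathlib

/-- `Iclass p n j` is the residue class `I_j = {x : 1 ≤ x ≤ p-1, x ≡ j (mod n)}`. -/
def Iclass (p n j : ℕ) : Finset ℕ :=
  (Finset.Icc 1 (p - 1)).filter fun x => x % n = j

/-- `fmap p A k x` is `A x^k mod p`, the least residue in `{0, …, p-1}`. -/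
def fmap (p : ℕ) (A : ℤ) (k : ℕ) (x : ℕ) : ℕ :=
  ((A : ZMod p) * (x : ZMod p) ^ k).val

/-- Signed form of `f(I_i) ⊆ I_j`: for `x ≡ i (mod n)` in `(0, p)`, the least positive residue of
`A (x/p) x` modulo `p` is congruent to `j` modulo `n`. -/
def MapsClass (p : ℕ) [Fact p.Prime] (n A i j : ℤ) : Prop :=
  ∀ x : ℤ, 0 < x → x < p → n ∣ x - i →
    ∃ q : ℤ, 0 < A * legendreSym p x * x - p * q ∧ A * legendreSym p x * x - p * q < p ∧
      n ∣ A * legendreSym p x * x - p * q - j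

theorem exists_dvd_sub_mem_Ioc {n : ℤ} (hn : 0 < n) (i N : ℤ) :
    ∃ x : ℤ, n ∣ x - i ∧ N < x ∧ x ≤ N + n := by
  refine ⟨N + n - (N - i) % n, ?_, ?_, ?_⟩
  · refine ⟨(N - i) / n + 1, ?_⟩
    linarith [Int.mul_ediv_add_emod (N - i) n]
  · linarith [Int.emod_lt_of_pos (N - i) hn]
  · linarith [Int.emod_nonneg (N - i) hn.ne']

theorem exists_dvd_sub_floor_eq {p : ℕ} {n A m : ℤ} (hn : 0 < n) (hA : 0 < A) (hAn : A * n < p)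
    (hm0 : 0 ≤ m) (hm : m < A) (i : ℤ) :
    ∃ x : ℤ, 0 < x ∧ x < p ∧ n ∣ x - i ∧ p * m ≤ A * x ∧ A * x < p * (m + 1) := by
  obtain ⟨x, hxi, h1, h2⟩ := exists_dvd_sub_mem_Ioc hn i (p * m / A)
  have e := Int.mul_ediv_add_emod (p * m) A
  have b1 := Int.emod_nonneg (p * m) hA.ne'
  have b2 := Int.emod_lt_of_pos (p * m) hA
  have h0 : 0 ≤ p * m / A := by positivity
  have h3 : A * (p * m / A + 1) ≤ A * x := by gcongr; omega
  have h4 : A * x ≤ A * (p * m / A + n) := by gcongr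
  have h5 : A * x < p * (m + 1) := by linarith
  have h6 : (p : ℤ) * (m + 1) ≤ p * A := by gcongr; omega
  exact ⟨x, by omega, lt_of_mul_lt_mul_left (a := A) (by linarith) hA.le, hxi, by linarith, h5⟩

section

variable {p : ℕ} [Fact p.Prime] {n A i j : ℤ}

theorem legendreSym_eq_one_or_neg_one_of_lt {x : ℤ} (hx : 0 < x) (hxp : x < p) :
    legendreSym p x = 1 ∨ legendreSym p x = -1 := by
  apply legendreSym.eq_one_or_neg_one
  rw [Ne, ZMod.intCast_zmod_eq_zero_iff_dvd]
  exact fun h => absurd (Int.le_of_dvd hx h) (by omega)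

theorem legendreSym_prime_sub (hp4 : p % 4 = 1) (x : ℤ) :
    legendreSym p (p - x) = legendreSym p x := by
  have h1 : legendreSym p (-1) = 1 := by
    rw [legendreSym.at_neg_one (by omega), ZMod.χ₄_nat_one_mod_four hp4]
  have h2 : legendreSym p (p - x) = legendreSym p (-1 * x) := by
    simp [legendreSym]
  rw [h2, legendreSym.mul, h1, one_mul]

theorem isCoprime_prime_of_lt (hn : 0 < n) (hnp : n < p) : IsCoprime n (p : ℤ) := by
  rw [isCoprime_comm, Prime.coprime_iff_not_dvd (Nat.prime_iff_prime_int.mp Fact.out)]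
  exact fun h => absurd (Int.le_of_dvd hn h) (by omega)

namespace MapsClass

theorem neg (h : MapsClass p n A i j) : MapsClass p n (-A) i (p - j) := by
  intro x hx hxp hxi
  obtain ⟨q, h1, h2, h3⟩ := h x hx hxp hxi
  refine ⟨-q - 1, by linarith, by linarith, ?_⟩
  exact (dvd_neg.mpr h3).trans (dvd_of_eq (by ring))

theorem reflect (hp4 : p % 4 = 1) (h : MapsClass p n A i j) :
    MapsClass p n A (p - i) (p - j) := by
  intro x hx hxp hxi
  obtain ⟨q, h1, h2, h3⟩ := h (p - x) (by linarith) (by linarith)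
    ((dvd_neg.mpr hxi).trans (dvd_of_eq (by ring)))
  rw [legendreSym_prime_sub hp4] at h1 h2 h3
  refine ⟨A * legendreSym p x - 1 - q, by linarith, by linarith, ?_⟩
  exact (dvd_neg.mpr h3).trans (dvd_of_eq (by ring))

theorem sign_cases (h : MapsClass p n A i j) {x m : ℤ} (hx : 0 < x) (hxp : x < p)
    (hxi : n ∣ x - i) (hm : p * m ≤ A * x) (hm' : A * x < p * (m + 1)) :
    legendreSym p x = 1 ∧ n ∣ A * x - p * m - j ∨
      legendreSym p x = -1 ∧ n ∣ -(A * x) + p * m + p - j := by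
  have hp0 : (0 : ℤ) < p := by omega
  obtain ⟨q, h1, h2, h3⟩ := h x hx hxp hxi
  rcases legendreSym_eq_one_or_neg_one_of_lt hx hxp with hs | hs <;> rw [hs] at h1 h2 h3
  · left
    have ha : q < m + 1 := lt_of_mul_lt_mul_left (by linarith) hp0.le
    have hb : m < q + 1 := lt_of_mul_lt_mul_left (a := (p : ℤ)) (by linarith) hp0.le
    obtain rfl : q = m := by omega
    exact ⟨hs, h3.trans (dvd_of_eq (by ring))⟩
  · right
    have ha : m < -q := lt_of_mul_lt_mul_left (a := (p : ℤ)) (by linarith) hp0.le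
    have hb : -q < m + 2 := lt_of_mul_lt_mul_left (a := (p : ℤ)) (by linarith) hp0.le
    obtain rfl : q = -m - 1 := by omega
    exact ⟨hs, h3.trans (dvd_of_eq (by ring))⟩

theorem dvd_sub_of_sign_eq (h : MapsClass p n A i j) (hn : 0 < n) (hnp : n < p) {x m y k : ℤ}
    (hx : 0 < x) (hxp : x < p) (hxi : n ∣ x - i) (hm : p * m ≤ A * x)
    (hm' : A * x < p * (m + 1))
    (hy : 0 < y) (hyp : y < p) (hyi : n ∣ y - i) (hk : p * k ≤ A * y)
    (hk' : A * y < p * (k + 1)) (hs : legendreSym p x = legendreSym p y) : n ∣ m - k := by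
  refine (isCoprime_prime_of_lt hn hnp).dvd_of_dvd_mul_left (?_ : n ∣ p * (m - k))
  have hxy : n ∣ A * (x - y) := Dvd.dvd.mul_left ((dvd_sub hxi hyi).trans (dvd_of_eq (by ring))) _
  rcases h.sign_cases hx hxp hxi hm hm' with ⟨h1, h2⟩ | ⟨h1, h2⟩ <;>
  rcases h.sign_cases hy hyp hyi hk hk' with ⟨h3, h4⟩ | ⟨h3, h4⟩
  · exact (dvd_sub hxy (dvd_sub h2 h4)).trans (dvd_of_eq (by ring))
  · omega
  · omega
  · exact (dvd_add hxy (dvd_sub h2 h4)).trans (dvd_of_eq (by ring))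

/-- If the Legendre symbol takes equal values at two consecutive terms, then `A n < p`. -/
theorem mul_lt_of_consecutive (h : MapsClass p n A i j) (hn : 2 ≤ n) (hnp : n < p) (hA : 0 < A)
    (hAp : 2 * A < p) {x : ℤ} (hx : 0 < x) (hxp : x + n < p) (hxi : n ∣ x - i)
    (hs : legendreSym p (x + n) = legendreSym p x) : A * n < p := by
  have hp0 : (0 : ℤ) < p := by omega
  have e1 := Int.mul_ediv_add_emod (A * x) p
  have e2 := Int.mul_ediv_add_emod (A * (x + n)) p
  have b1 := Int.emod_nonneg (A * x) hp0.ne'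
  have b2 := Int.emod_lt_of_pos (A * x) hp0
  have b3 := Int.emod_nonneg (A * (x + n)) hp0.ne'
  have b4 := Int.emod_lt_of_pos (A * (x + n)) hp0
  obtain ⟨l, hl⟩ := h.dvd_sub_of_sign_eq (by omega) hnp (x := x + n) (y := x)
    (m := A * (x + n) / p) (k := A * x / p) (by omega) hxp
    ((dvd_add hxi (dvd_refl n)).trans (dvd_of_eq (by ring))) (by linarith) (by linarith)
    hx (by omega) hxi (by linarith) (by linarith) hs
  have hd : (p : ℤ) * (A * (x + n) / p) - p * (A * x / p) = p * (n * l) := by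
    rw [← hl]; ring
  have hlt : n * (A - p * l) < p := by linarith
  have hgt : n * (p * l - A) < p := by linarith
  rcases lt_trichotomy l 0 with h0 | h0 | h0
  · have : (p : ℤ) * l ≤ p * (-1) := by gcongr; omega
    nlinarith
  · subst h0; linarith
  · have : (p : ℤ) * 1 ≤ p * l := by gcongr; omega
    nlinarith

theorem lt_three (h : MapsClass p n A i j) (hn : 3 ≤ n) (hnp : n < p) (hAn : A * n < p) :
    A < 3 := by
  by_contra! hA
  obtain ⟨x, x0, xp, xi, x1, x2⟩ :=
    exists_dvd_sub_floor_eq (by omega) (by omega) hAn le_rfl (by omega : 0 < A) i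
  obtain ⟨y, y0, yp, yi, y1, y2⟩ :=
    exists_dvd_sub_floor_eq (by omega) (by omega) hAn zero_le_one (by omega : 1 < A) i
  obtain ⟨z, z0, zp, zi, z1, z2⟩ :=
    exists_dvd_sub_floor_eq (by omega) (by omega) hAn zero_le_two (by omega : 2 < A) i
  have hyx : legendreSym p y ≠ legendreSym p x := fun hs => absurd (Int.le_of_dvd (by norm_num)
    (h.dvd_sub_of_sign_eq (by omega) hnp y0 yp yi y1 y2 x0 xp xi x1 x2 hs)) (by omega)
  have hzx : legendreSym p z ≠ legendreSym p x := fun hs => absurd (Int.le_of_dvd (by norm_num)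
    (h.dvd_sub_of_sign_eq (by omega) hnp z0 zp zi z1 z2 x0 xp xi x1 x2 hs)) (by omega)
  have hzy : legendreSym p z ≠ legendreSym p y := fun hs => absurd (Int.le_of_dvd (by norm_num)
    (h.dvd_sub_of_sign_eq (by omega) hnp z0 zp zi z1 z2 y0 yp yi y1 y2 hs)) (by omega)
  have := legendreSym_eq_one_or_neg_one_of_lt x0 xp
  have := legendreSym_eq_one_or_neg_one_of_lt y0 yp
  have := legendreSym_eq_one_or_neg_one_of_lt z0 zp
  omega

theorem two_false (hn : 2 ≤ n) (hpn : 9 * n ^ 2 < p) (h : MapsClass p n 2 i j) : False := by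
  have hnp : n < p := by nlinarith
  have key : ∀ x y : ℤ, 0 < x → 2 * x < p → n ∣ x - i → p < 2 * y → y < p → n ∣ y - i →
      legendreSym p y ≠ legendreSym p x := by
    intro x y x0 xp xi yp y1 yi hs
    have := h.dvd_sub_of_sign_eq (m := 1) (k := 0) (by omega) hnp (by omega) y1 yi (by omega)
      (by omega) x0 (by omega) xi (by omega) (by omega) hs
    exact absurd (Int.le_of_dvd (by norm_num) this) (by omega)
  have hmul : ∀ x : ℤ, n ∣ x - i → n ∣ (n + 1) * x - i := by
    intro x hx
    exact (dvd_add hx (dvd_mul_right n x)).trans (dvd_of_eq (by ring))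
  obtain ⟨x, xi, x1, x2⟩ := exists_dvd_sub_mem_Ioc (n := n) (by omega) i 0
  obtain ⟨y, yi, y1, y2⟩ := exists_dvd_sub_mem_Ioc (n := n) (by omega) i (p / (2 * (n + 1)))
  have e := Int.mul_ediv_add_emod p (2 * (n + 1))
  have b1 := Int.emod_nonneg (p : ℤ) (by omega : 2 * (n + 1) ≠ 0)
  have b2 := Int.emod_lt_of_pos (p : ℤ) (by omega : 0 < 2 * (n + 1))
  have h0 : (0 : ℤ) ≤ p / (2 * (n + 1)) := by positivity
  have hx : 2 * ((n + 1) * x) < p := by nlinarith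
  have hlow : p < 2 * ((n + 1) * y) := by nlinarith
  have hhigh : 2 * ((n + 1) * y) ≤ p + 2 * (n + 1) * n := by nlinarith
  have hy : (n + 1) * y < p := by nlinarith
  have hy2 : 2 * y < p := by nlinarith
  have hx2 : 2 * x < p := by nlinarith
  have k1 := key x _ (by omega) hx2 xi hlow hy (hmul y yi)
  have k2 := key y _ (by omega) hy2 yi hlow hy (hmul y yi)
  have k3 := key ((n + 1) * x) _ (by positivity) hx (hmul x xi) hlow hy (hmul y yi)
  have s1 := legendreSym_eq_one_or_neg_one_of_lt (p := p) (x := x) (by omega) (by omega)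
  have s2 := legendreSym_eq_one_or_neg_one_of_lt (p := p) (x := y) (by omega) (by omega)
  have s3 := legendreSym_eq_one_or_neg_one_of_lt (p := p) (x := n + 1) (by omega) (by nlinarith)
  rw [legendreSym.mul p (n + 1) y] at k1 k2 k3
  rw [legendreSym.mul] at k3
  rcases s1 with s1 | s1 <;> rcases s2 with s2 | s2 <;> rcases s3 with s3 | s3 <;>
    simp [s1, s2, s3] at k1 k2 k3

theorem modulus_two_even_false (hp : 36 < p) (hA : 2 ≤ A) (hAp : 2 * A < p) (hi : 2 ∣ i)
    (h : MapsClass p 2 A i j) : False := by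
  have hpar : ∀ y m : ℤ, 0 < y → 2 * y < p → p * m ≤ 2 * A * y → 2 * A * y < p * (m + 1) →
      legendreSym p (2 * y) = 1 ∧ (2 : ℤ) ∣ p * m + j ∨
        legendreSym p (2 * y) = -1 ∧ (2 : ℤ) ∣ p * m + p + j := by
    intro y m y0 yp h1 h2
    have hd : (2 : ℤ) ∣ A * (2 * y) := ⟨A * y, by ring⟩
    rcases h.sign_cases (x := 2 * y) (m := m) (by omega) yp (by omega)
      (by linarith) (by linarith) with h3 | h3
    · left; exact ⟨h3.1, by omega⟩
    · right; exact ⟨h3.1, by omega⟩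
  have hodd : (p : ℤ) % 2 = 1 := by
    rcases (Fact.out : p.Prime).eq_two_or_odd with h | h <;> omega
  have h1 := hpar 1 0 (by omega) (by omega) (by omega) (by omega)
  have s2 := legendreSym_eq_one_or_neg_one_of_lt (p := p) (x := 2) (by omega) (by omega)
  have hsign : ∀ y m : ℤ, 0 < y → 2 * y < p → p * m ≤ 2 * A * y → 2 * A * y < p * (m + 1) →
      legendreSym p y = 1 ∧ m % 2 = 0 ∨ legendreSym p y = -1 ∧ m % 2 = 1 := by
    intro y m y0 yp ha hb
    have hy := hpar y m y0 yp ha hb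
    have hpm : (p * m) % 2 = m % 2 := by rw [Int.mul_emod, hodd]; simp
    have sy := legendreSym_eq_one_or_neg_one_of_lt (p := p) (x := y) (by omega) (by omega)
    rw [legendreSym.mul] at hy
    rw [mul_one] at h1
    rcases s2 with s2 | s2 <;> rcases sy with sy | sy <;> rw [s2] at h1 hy <;>
      rw [sy] at hy ⊢ <;> omega
  have hdouble : ∀ y : ℤ, legendreSym p (2 * y) = legendreSym p 2 * legendreSym p y :=
    fun y => legendreSym.mul p 2 y
  rcases lt_or_ge (4 * A) p with h4 | h4
  · have t2 := hsign 2 0 (by omega) (by omega) (by omega) (by omega)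
    have e := Int.mul_ediv_add_emod (p : ℤ) (4 * A)
    have b1 := Int.emod_nonneg (p : ℤ) (by omega : 4 * A ≠ 0)
    have b2 := Int.emod_lt_of_pos (p : ℤ) (by omega : 0 < 4 * A)
    have h0 : (0 : ℤ) ≤ p / (4 * A) := by positivity
    set y : ℤ := p / (4 * A) + 1 with hy
    have e1 : 4 * A * y = 4 * A * (p / (4 * A)) + 4 * A := by rw [hy]; ring
    have hy4 : 2 * (2 * y) < p := by nlinarith
    have ty := hsign y 0 (by omega) (by omega) (by nlinarith) (by linarith)
    have t2y := hsign (2 * y) 1 (by omega) hy4 (by linarith) (by linarith)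
    rw [hdouble] at t2y
    rcases t2 with ⟨t2, -⟩ | ⟨-, t2⟩ <;> rcases ty with ⟨ty, -⟩ | ⟨-, ty⟩ <;>
      simp [t2, ty] at t2y <;> omega
  · have t2 := hsign 2 1 (by omega) (by omega) (by omega) (by omega)
    have hd2 := hdouble 2
    have hd3 := hdouble 3
    have hd4 := hdouble 4
    norm_num at hd2 hd3 hd4
    have s2' : legendreSym p 2 = -1 := by omega
    rw [s2'] at hd2 hd3 hd4
    have h8 : 8 * A < p * 3 := by
      by_contra! hc
      have := hsign 4 3 (by omega) (by omega) (by omega) (by omega)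
      omega
    have h16 : p * 5 ≤ 16 * A := by
      by_contra! hc
      have := hsign 8 4 (by omega) (by omega) (by omega) (by omega)
      omega
    rcases lt_or_ge (6 * A) (p * 2) with h6 | h6
    · have t3 := hsign 3 1 (by omega) (by omega) (by omega) (by omega)
      have t6 := hsign 6 3 (by omega) (by omega) (by omega) (by omega)
      omega
    · have t3 := hsign 3 2 (by omega) (by omega) (by omega) (by omega)
      have t6 := hsign 6 4 (by omega) (by omega) (by omega) (by omega)
      omega

theorem modulus_two_false (hp4 : p % 4 = 1) (hp : 36 < p) (hA : 2 ≤ A) (hAp : 2 * A < p)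
    (h : MapsClass p 2 A i j) : False := by
  by_cases hi : 2 ∣ i
  · exact h.modulus_two_even_false hp hA hAp hi
  · exact (h.reflect hp4).modulus_two_even_false hp hA hAp (by omega)

end MapsClass

theorem legendreSym_add_one_eq_of_alternating (hn : 0 < n)
    (halt : ∀ x : ℤ, 0 < x → x + n < p → n ∣ x - i → legendreSym p (x + n) = -legendreSym p x)
    {x : ℤ} (hx : 0 < x) (hxp : (n + 1) * x < p) (hxi : n ∣ x - i) :
    legendreSym p (n + 1) = (-1) ^ x.toNat := by
  have step : ∀ k : ℕ, x + k * n < p →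
      legendreSym p (x + k * n) = (-1) ^ k * legendreSym p x := by
    intro k
    induction k with
    | zero => simp
    | succ k ih =>
      intro hk
      push_cast at hk ⊢
      have h0 : (0 : ℤ) ≤ k * n := by positivity
      have := halt (x + k * n) (by omega) (by linarith)
        ((dvd_add hxi (dvd_mul_left n k)).trans (dvd_of_eq (by ring)))
      rw [show x + (k + 1) * n = x + k * n + n by ring, this, ih (by linarith)]
      ring
  have hc : (x.toNat : ℤ) = x := Int.toNat_of_nonneg hx.le
  have h1 := step x.toNat (by rw [hc]; linarith)
  rw [hc, show x + x * n = (n + 1) * x by ring, legendreSym.mul] at h1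
  have hxlt : x < p := by nlinarith
  rcases legendreSym_eq_one_or_neg_one_of_lt hx hxlt with s | s <;> rw [s] at h1 <;> linarith

theorem exists_consecutive_legendreSym_eq (hp4 : p % 4 = 1) (hn : 2 ≤ n) (hpn : 9 * n ^ 2 < p)
    (i : ℤ) : ∃ x : ℤ, 0 < x ∧ x + n < p ∧ n ∣ x - i ∧
      legendreSym p (x + n) = legendreSym p x := by
  by_contra! hc
  have halt : ∀ x : ℤ, 0 < x → x + n < p → n ∣ x - i →
      legendreSym p (x + n) = -legendreSym p x := by
    intro x hx hxp hxi
    have := hc x hx hxp hxi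
    have := legendreSym_eq_one_or_neg_one_of_lt (p := p) (x := x) hx (by omega)
    have := legendreSym_eq_one_or_neg_one_of_lt (p := p) (x := x + n) (by omega) hxp
    omega
  have halt' : ∀ x : ℤ, 0 < x → x + n < p → n ∣ x - (p - i) →
      legendreSym p (x + n) = -legendreSym p x := by
    intro x hx hxp hxi
    have := halt (p - (x + n)) (by omega) (by omega)
      ((dvd_neg.mpr (dvd_add hxi (dvd_refl n))).trans (dvd_of_eq (by ring)))
    rw [show (p : ℤ) - (x + n) + n = p - x by ring, legendreSym_prime_sub hp4,
      legendreSym_prime_sub hp4] at this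
    omega
  obtain ⟨x, xi, x1, x2⟩ := exists_dvd_sub_mem_Ioc (n := n) (by omega) i 0
  obtain ⟨y, yi, y1, y2⟩ := exists_dvd_sub_mem_Ioc (n := n) (by omega) (p - i) 0
  have hx := legendreSym_add_one_eq_of_alternating (by omega) halt x1 (by nlinarith) xi
  have hparity : ∀ z : ℤ, 0 < z → legendreSym p (n + 1) = (-1) ^ z.toNat → z % 2 = x % 2 := by
    intro z hz h
    rw [hx] at h
    rcases Nat.even_or_odd x.toNat with ex | ex <;> rcases Nat.even_or_odd z.toNat with ez | ez <;>
      rw [ex.neg_one_pow, ez.neg_one_pow] at h <;> first | omega | skip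
    · rw [Nat.even_iff] at ex ez; omega
    · rw [Nat.odd_iff] at ex ez; omega
  have hxn := hparity (x + n) (by omega) (legendreSym_add_one_eq_of_alternating (by omega) halt
    (by omega) (by nlinarith) ((dvd_add xi (dvd_refl n)).trans (dvd_of_eq (by ring))))
  have hy := hparity y y1 (legendreSym_add_one_eq_of_alternating (by omega) halt' y1
    (by nlinarith) yi)
  have hn2 : (2 : ℤ) ∣ n := by omega
  have h1 := hn2.trans xi
  have h2 := hn2.trans yi
  omega

theorem MapsClass.false (hp4 : p % 4 = 1) (hn : 2 ≤ n) (hpn : 9 * n ^ 2 < p) (hA : 2 ≤ A)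
    (hAp : 2 * A < p) (h : MapsClass p n A i j) : False := by
  obtain rfl | hn3 := hn.eq_or_lt
  · exact h.modulus_two_false hp4 (by omega) hA hAp
  have hnp : n < p := by nlinarith
  obtain ⟨x, hx, hxp, hxi, hs⟩ := exists_consecutive_legendreSym_eq hp4 hn hpn i
  have hlt := h.lt_three (by omega) hnp
    (h.mul_lt_of_consecutive hn hnp (by omega) hAp hx hxp hxi hs)
  obtain rfl : A = 2 := by omega
  exact h.two_false hn hpn

end

theorem fmap_eq_legendreSym {p : ℕ} [Fact p.Prime] (hp : p % 2 = 1) (A : ℤ) (x : ℕ) :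
    (fmap p A ((p + 1) / 2) x : ℤ) = A * legendreSym p x * x % p := by
  have hcast : ((A * legendreSym p x * x : ℤ) : ZMod p) = A * x ^ ((p + 1) / 2) := by
    push_cast
    rw [legendreSym.eq_pow, show (p + 1) / 2 = p / 2 + 1 by omega]
    push_cast
    ring
  rw [fmap, ← hcast, ZMod.val_intCast]

theorem mapsClass_of_image_subset {p n i j : ℕ} {A : ℤ} [Fact p.Prime] (hp : p % 2 = 1)
    (hi : i < n)
    (h : (Iclass p n i).image (fmap p A ((p + 1) / 2)) ⊆ Iclass p n j) :
    MapsClass p n A i j := by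
  intro x hx hxp hxi
  lift x to ℕ using hx.le
  have hxi' : x % n = i := by
    have : (i : ℤ) ≡ x [ZMOD n] := Int.modEq_iff_dvd.mpr hxi
    rw [Int.natCast_modEq_iff] at this
    rw [← Nat.mod_eq_of_lt hi]
    exact this.symm
  have hmem : x ∈ Iclass p n i := by
    simp only [Iclass, Finset.mem_filter, Finset.mem_Icc]
    omega
  have hf := h (Finset.mem_image_of_mem _ hmem)
  simp only [Iclass, Finset.mem_filter, Finset.mem_Icc] at hf
  have hval := fmap_eq_legendreSym hp A x
  refine ⟨A * legendreSym p x * x / p, ?_⟩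
  have e : A * legendreSym p x * x - p * (A * legendreSym p x * x / p) =
      fmap p A ((p + 1) / 2) x := by
    rw [hval, Int.emod_def]
  rw [e]
  refine ⟨by omega, by omega, ?_⟩
  rw [← hf.2, Int.natCast_mod]
  exact Int.dvd_self_sub_emod

theorem stmt_19 (p n : ℕ) (A : ℤ) (hp : p.Prime) (hp4 : p % 4 = 1) (hn : 2 ≤ n)
    (hpn : 9 * n ^ 2 < p) (hA : 2 * |A| < (p : ℤ)) (hA0 : A ≠ 0)
    (hA1 : A ≠ 1) (hA1' : A ≠ -1) :
    ∀ i j : ℕ, i ≤ n - 1 → j ≤ n - 1 →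
      ¬ ((Iclass p n i).image (fmap p A ((p + 1) / 2)) ⊆ Iclass p n j) := by
  intro i j hi _ h
  have : Fact p.Prime := ⟨hp⟩
  have hM := mapsClass_of_image_subset (by omega) (by omega) h
  have hn' : (2 : ℤ) ≤ n := by exact_mod_cast hn
  have hpn' : 9 * (n : ℤ) ^ 2 < p := by exact_mod_cast hpn
  rcases abs_cases A with ⟨ha, _⟩ | ⟨ha, _⟩ <;> rw [ha] at hA
  · exact hM.false hp4 hn' hpn' (by omega) hA
  · exact hM.neg.false hp4 hn' hpn' (by omega) hA
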